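/- arXiv:2508.09047 — 2 statements merged into one kernel-verified Lean document; each statement's English description precedes it below -/
import Mathlib

section
/- Let n ≥ 2 and let Φ ∈ H with Φ ≠ 0. Then ψ⁻_Φ is a solution of the spinorial Yamabe equation on ℝⁿ: for every x ∈ ℝⁿ, D ψ⁻_Φ(x) = μ · ‖ψ⁻_Φ(x)‖^{2/(n−1)} · ψ⁻_Φ(x), where μ = n · 2^{−n/(n−1)} · ‖Φ‖^{−2/(n−1)} > 0. -/
open scoped RealInnerProductSpace
open MeasureTheory

noncomputable section

/-- The Dirac operator on spinor fields `ψ : ℝⁿ → H`, relative to Clifford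
multiplication `γ` and the standard orthonormal basis of `ℝⁿ`. -/
def Dirac {n : ℕ} {H : Type*} [NormedAddCommGroup H] [InnerProductSpace ℝ H]
    (γ : EuclideanSpace ℝ (Fin n) →ₗ[ℝ] H →ₗ[ℝ] H)
    (ψ : EuclideanSpace ℝ (Fin n) → H) (x : EuclideanSpace ℝ (Fin n)) : H :=
  ∑ i : Fin n, γ (EuclideanSpace.single i (1 : ℝ))
    (fderiv ℝ ψ x (EuclideanSpace.single i (1 : ℝ)))

/-- The spinor bubble `ψ⁻_Φ(x) = (2/(1+‖x‖²))^{n/2} (Φ − γ(x)Φ)`. -/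
def psiNeg {n : ℕ} {H : Type*} [NormedAddCommGroup H] [InnerProductSpace ℝ H]
    (γ : EuclideanSpace ℝ (Fin n) →ₗ[ℝ] H →ₗ[ℝ] H)
    (Φ : H) (x : EuclideanSpace ℝ (Fin n)) : H :=
  (((2 / (1 + ‖x‖ ^ 2) : ℝ)) ^ ((n : ℝ) / 2)) • (Φ - γ x Φ)

/-- The spinor bubble `ψ⁺_Φ(x) = (2/(1+‖x‖²))^{n/2} (Φ + γ(x)Φ)`. -/
def psiPos {n : ℕ} {H : Type*} [NormedAddCommGroup H] [InnerProductSpace ℝ H]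
    (γ : EuclideanSpace ℝ (Fin n) →ₗ[ℝ] H →ₗ[ℝ] H)
    (Φ : H) (x : EuclideanSpace ℝ (Fin n)) : H :=
  (((2 / (1 + ‖x‖ ^ 2) : ℝ)) ^ ((n : ℝ) / 2)) • (Φ + γ x Φ)

/-- Gradient of a real power of the conformal factor `2 / (1 + ‖x‖²)`. -/
lemma hasFDerivAt_conformalFactor_rpow {E : Type*} [NormedAddCommGroup E]
    [InnerProductSpace ℝ E] (a : ℝ) (x : E) :
    HasFDerivAt (fun y : E => (2 / (1 + ‖y‖ ^ 2) : ℝ) ^ a)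
      ((-(a * (2 / (1 + ‖x‖ ^ 2) : ℝ) ^ (a + 1))) • innerSL ℝ x) x := by
  have hpos : (0 : ℝ) < 1 + ‖x‖ ^ 2 := by positivity
  have hf : (0 : ℝ) < 2 / (1 + ‖x‖ ^ 2) := by positivity
  have hd : HasDerivAt (fun t : ℝ => (2 / (1 + t)) ^ a)
      (-(a * (2 / (1 + ‖x‖ ^ 2) : ℝ) ^ (a + 1)) / 2) (‖x‖ ^ 2) := by
    have h1 : HasDerivAt (fun t : ℝ => 1 + t) 1 (‖x‖ ^ 2) := (hasDerivAt_id _).const_add 1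
    have h2 := ((hasDerivAt_const (‖x‖ ^ 2) (2 : ℝ)).div h1 hpos.ne').rpow_const (p := a)
      (Or.inl hf.ne')
    refine h2.congr_deriv ?_
    have e1 : (2 / (1 + ‖x‖ ^ 2) : ℝ) ^ (a + 1) =
        (2 / (1 + ‖x‖ ^ 2)) ^ (a - 1) * (2 / (1 + ‖x‖ ^ 2)) ^ 2 := by
      rw [← Real.rpow_natCast (2 / (1 + ‖x‖ ^ 2)) 2, ← Real.rpow_add hf]
      congr 1
      push_cast
      ring
    rw [Pi.div_apply, e1]
    field_simp
    ring
  have h := hd.comp_hasFDerivAt x (hasStrictFDerivAt_norm_sq x).hasFDerivAt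
  refine h.congr_fderiv ?_
  ext v
  simp
  ring

section CliffordModule

variable {n : ℕ} {H : Type*} [NormedAddCommGroup H] [InnerProductSpace ℝ H]
  {γ : EuclideanSpace ℝ (Fin n) →ₗ[ℝ] H →ₗ[ℝ] H}

/-- The square of Clifford multiplication by `v` is `-‖v‖²`. -/
lemma clifford_mul_self
    (hcl : ∀ (v w : EuclideanSpace ℝ (Fin n)) (ψ : H),
      γ v (γ w ψ) + γ w (γ v ψ) = (-2 * ⟪v, w⟫) • ψ)
    (v : EuclideanSpace ℝ (Fin n)) (ψ : H) : γ v (γ v ψ) = -(‖v‖ ^ 2) • ψ := by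
  have h := hcl v v ψ
  rw [real_inner_self_eq_norm_sq, ← two_smul ℝ, mul_comm, mul_neg, mul_comm, ← mul_neg,
    mul_smul] at h
  exact smul_right_injective H (two_ne_zero' ℝ) h

/-- `Φ` and `γ(x)Φ` are orthogonal, so `‖Φ - γ(x)Φ‖² = (1 + ‖x‖²) ‖Φ‖²`. -/
lemma norm_sub_clifford_sq
    (hcl : ∀ (v w : EuclideanSpace ℝ (Fin n)) (ψ : H),
      γ v (γ w ψ) + γ w (γ v ψ) = (-2 * ⟪v, w⟫) • ψ)
    (hsk : ∀ (v : EuclideanSpace ℝ (Fin n)) (φ ψ : H), ⟪γ v φ, ψ⟫ = - ⟪φ, γ v ψ⟫)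
    (Φ : H) (x : EuclideanSpace ℝ (Fin n)) :
    ‖Φ - γ x Φ‖ ^ 2 = (1 + ‖x‖ ^ 2) * ‖Φ‖ ^ 2 := by
  have horth : ⟪Φ, γ x Φ⟫ = 0 := by
    have h := hsk x Φ Φ
    rw [real_inner_comm] at h
    linarith
  have hnorm : ‖γ x Φ‖ ^ 2 = ‖x‖ ^ 2 * ‖Φ‖ ^ 2 := by
    rw [← real_inner_self_eq_norm_sq, hsk, clifford_mul_self hcl, inner_smul_right,
      real_inner_self_eq_norm_sq]
    ring
  rw [norm_sub_sq_real, horth, hnorm]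
  ring

lemma fderiv_psiNeg_apply (γ : EuclideanSpace ℝ (Fin n) →ₗ[ℝ] H →ₗ[ℝ] H)
    (Φ : H) (x v : EuclideanSpace ℝ (Fin n)) :
    fderiv ℝ (psiNeg γ Φ) x v =
      -((2 / (1 + ‖x‖ ^ 2) : ℝ) ^ ((n : ℝ) / 2)) • γ v Φ -
        ((n : ℝ) / 2 * (2 / (1 + ‖x‖ ^ 2) : ℝ) ^ ((n : ℝ) / 2 + 1) * ⟪x, v⟫) •
          (Φ - γ x Φ) := by
  have hγ : HasFDerivAt (fun y => Φ - γ y Φ) (-(γ.flip Φ).toContinuousLinearMap) x :=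
    (γ.flip Φ).toContinuousLinearMap.hasFDerivAt.const_sub Φ
  have h := (hasFDerivAt_conformalFactor_rpow ((n : ℝ) / 2) x).smul hγ
  have h' : HasFDerivAt (psiNeg γ Φ) _ x := h
  rw [h'.fderiv]
  simp [sub_eq_add_neg]
  abel

/-- The bubble `ψ⁻_Φ` satisfies `D ψ = (n / 2) f ψ`, where `f = 2 / (1 + ‖x‖²)`. -/
lemma dirac_psiNeg
    (hcl : ∀ (v w : EuclideanSpace ℝ (Fin n)) (ψ : H),
      γ v (γ w ψ) + γ w (γ v ψ) = (-2 * ⟪v, w⟫) • ψ)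
    (Φ : H) (x : EuclideanSpace ℝ (Fin n)) :
    Dirac γ (psiNeg γ Φ) x = ((n : ℝ) / 2 * (2 / (1 + ‖x‖ ^ 2))) • psiNeg γ Φ x := by
  have hf : (0 : ℝ) < 2 / (1 + ‖x‖ ^ 2) := by positivity
  have hx : ∑ i, ⟪x, EuclideanSpace.single i (1 : ℝ)⟫ • EuclideanSpace.single i (1 : ℝ) = x := by
    simpa [real_inner_comm] using (EuclideanSpace.basisFun (Fin n) ℝ).sum_repr' x
  have hsum (ψ : H) : ∑ i, ⟪x, EuclideanSpace.single i (1 : ℝ)⟫ •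
      γ (EuclideanSpace.single i (1 : ℝ)) ψ = γ x ψ := by
    conv_rhs => rw [← hx]
    simp [map_sum]
  unfold Dirac
  simp only [fderiv_psiNeg_apply, map_sub (γ _), map_smul (γ _), clifford_mul_self hcl,
    mul_smul, smul_sub, Finset.sum_sub_distrib, ← Finset.smul_sum, hsum]
  rw [psiNeg, Real.rpow_add_one hf.ne']
  simp only [PiLp.norm_single, norm_one, Finset.sum_const, Finset.card_univ,
    Fintype.card_fin, ← Nat.cast_smul_eq_nsmul ℝ]
  match_scalars
  · field_simp
    ring
  · field_simp

/-- The Yamabe power of the norm of a bubble is a multiple of the conformal factor. -/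
lemma norm_psiNeg_rpow
    (hn : 2 ≤ n)
    (hcl : ∀ (v w : EuclideanSpace ℝ (Fin n)) (ψ : H),
      γ v (γ w ψ) + γ w (γ v ψ) = (-2 * ⟪v, w⟫) • ψ)
    (hsk : ∀ (v : EuclideanSpace ℝ (Fin n)) (φ ψ : H), ⟪γ v φ, ψ⟫ = - ⟪φ, γ v ψ⟫)
    (Φ : H) (x : EuclideanSpace ℝ (Fin n)) :
    ‖psiNeg γ Φ x‖ ^ ((2 : ℝ) / ((n : ℝ) - 1)) =
      2 ^ (1 / ((n : ℝ) - 1)) * (2 / (1 + ‖x‖ ^ 2)) * ‖Φ‖ ^ ((2 : ℝ) / ((n : ℝ) - 1)) := by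
  have hn1 : (n : ℝ) - 1 ≠ 0 := by
    have : (2 : ℝ) ≤ n := by exact_mod_cast hn
    linarith
  have hf : (0 : ℝ) < 2 / (1 + ‖x‖ ^ 2) := by positivity
  have hsq : ‖psiNeg γ Φ x‖ ^ 2 =
      2 * (2 / (1 + ‖x‖ ^ 2)) ^ ((n : ℝ) - 1) * ‖Φ‖ ^ 2 := by
    rw [psiNeg, norm_smul, Real.norm_of_nonneg (by positivity), mul_pow,
      norm_sub_clifford_sq hcl hsk, ← Real.rpow_mul_natCast hf.le, Real.rpow_sub_one hf.ne']
    have : (n : ℝ) / 2 * (2 : ℕ) = n := by push_cast; ring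
    rw [this]
    field_simp
  have hpow (t : ℝ) (ht : 0 ≤ t) :
      t ^ ((2 : ℝ) / ((n : ℝ) - 1)) = (t ^ 2) ^ (1 / ((n : ℝ) - 1)) := by
    rw [← Real.rpow_natCast_mul ht]
    congr 1
    push_cast
    ring
  rw [hpow _ (norm_nonneg _), hpow _ (norm_nonneg _), hsq,
    Real.mul_rpow (by positivity) (by positivity), Real.mul_rpow (by positivity) (by positivity),
    ← Real.rpow_mul hf.le, mul_one_div_cancel hn1, Real.rpow_one]

end CliffordModule

/-- For `n ≥ 2` and `0 ≠ Φ ∈ H`, the spinor bubble `ψ⁻_Φ` solves the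
spinorial Yamabe equation `D ψ⁻_Φ = μ ‖ψ⁻_Φ‖^{2/(n−1)} ψ⁻_Φ` on `ℝⁿ`, with
`μ = n · 2^{−n/(n−1)} · ‖Φ‖^{−2/(n−1)} > 0`. -/
theorem psiNeg_solves_spinorial_yamabe {n : ℕ} {H : Type*} [NormedAddCommGroup H]
    [InnerProductSpace ℝ H] [FiniteDimensional ℝ H]
    (hn : 2 ≤ n)
    (γ : EuclideanSpace ℝ (Fin n) →ₗ[ℝ] H →ₗ[ℝ] H)
    (hcl : ∀ (v w : EuclideanSpace ℝ (Fin n)) (ψ : H),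
      γ v (γ w ψ) + γ w (γ v ψ) = (-2 * ⟪v, w⟫) • ψ)
    (hsk : ∀ (v : EuclideanSpace ℝ (Fin n)) (φ ψ : H),
      ⟪γ v φ, ψ⟫ = - ⟪φ, γ v ψ⟫)
    (Φ : H) (hΦ : Φ ≠ 0) :
    (0 : ℝ) < (n : ℝ) * (2 : ℝ) ^ (-(n : ℝ) / ((n : ℝ) - 1)) *
        ‖Φ‖ ^ (-(2 : ℝ) / ((n : ℝ) - 1)) ∧
    ∀ x : EuclideanSpace ℝ (Fin n),
      Dirac γ (psiNeg γ Φ) x =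
        (((n : ℝ) * (2 : ℝ) ^ (-(n : ℝ) / ((n : ℝ) - 1)) *
            ‖Φ‖ ^ (-(2 : ℝ) / ((n : ℝ) - 1))) *
          ‖psiNeg γ Φ x‖ ^ ((2 : ℝ) / ((n : ℝ) - 1))) • psiNeg γ Φ x := by
  have hn1 : (n : ℝ) - 1 ≠ 0 := by
    have : (2 : ℝ) ≤ n := by exact_mod_cast hn
    linarith
  have hΦ' : 0 < ‖Φ‖ := norm_pos_iff.mpr hΦ
  refine ⟨by positivity, fun x => ?_⟩
  rw [dirac_psiNeg hcl, norm_psiNeg_rpow hn hcl hsk]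
  congr 1
  have h2 : (2 : ℝ) ^ (-(n : ℝ) / ((n : ℝ) - 1)) * 2 ^ (1 / ((n : ℝ) - 1)) = 1 / 2 := by
    rw [← Real.rpow_add two_pos, ← add_div, show -(n : ℝ) + 1 = -(n - 1) by ring, neg_div,
      div_self hn1, Real.rpow_neg_one, one_div]
  have hΦ2 : ‖Φ‖ ^ (-(2 : ℝ) / ((n : ℝ) - 1)) * ‖Φ‖ ^ ((2 : ℝ) / ((n : ℝ) - 1)) = 1 := by
    rw [← Real.rpow_add hΦ', neg_div, neg_add_cancel, Real.rpow_zero]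
  linear_combination (-(n : ℝ) * (2 / (1 + ‖x‖ ^ 2))) * h2 -
    ((n : ℝ) * (2 / (1 + ‖x‖ ^ 2)) * (2 : ℝ) ^ (-(n : ℝ) / ((n : ℝ) - 1)) *
      2 ^ (1 / ((n : ℝ) - 1))) * hΦ2
end
end

section
/- Let n ≥ 2 and let Φ₀, Φ₁ ∈ H, not both zero, satisfy ⟨Φ₀, Φ₁⟩ = 0 and ⟨Φ₀, γ(v)Φ₁⟩ = 0 for every v ∈ ℝⁿ. Set φ = ψ⁻_{Φ₀} + ψ⁺_{Φ₁}. Then Dφ(x) ≠ 0 for all x, and there exists a constant μ̃ > 0 such that the map Θ(x) = ‖Dφ(x)‖^{−2/(n+1)} Dφ(x) satisfies the degenerate Euler–Lagrange equation D Θ(x) = μ̃ · ‖φ(x)‖^{2/(n−1)} · φ(x) for every x ∈ ℝⁿ. -/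
open scoped RealInnerProductSpace
open MeasureTheory

noncomputable section

section SpinorBubble

variable {n : ℕ} {H : Type*} [NormedAddCommGroup H] [InnerProductSpace ℝ H]

/-- The field `x ↦ (2/(1+‖x‖²))^{n/2} (A − γ(x)B)`, a common form of both spinor bubbles. -/
def spinorBubble (γ : EuclideanSpace ℝ (Fin n) →ₗ[ℝ] H →ₗ[ℝ] H) (A B : H)
    (x : EuclideanSpace ℝ (Fin n)) : H :=
  ((2 / (1 + ‖x‖ ^ 2) : ℝ) ^ ((n : ℝ) / 2)) • (A - γ x B)

lemma spinorBubble_smul (γ : EuclideanSpace ℝ (Fin n) →ₗ[ℝ] H →ₗ[ℝ] H) (c : ℝ) (A B : H)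
    (x : EuclideanSpace ℝ (Fin n)) :
    spinorBubble γ (c • A) (c • B) x = c • spinorBubble γ A B x := by
  rw [spinorBubble, spinorBubble, map_smul, ← smul_sub, smul_comm]

lemma psiNeg_add_psiPos (γ : EuclideanSpace ℝ (Fin n) →ₗ[ℝ] H →ₗ[ℝ] H) (Φ₀ Φ₁ : H)
    (x : EuclideanSpace ℝ (Fin n)) :
    psiNeg γ Φ₀ x + psiPos γ Φ₁ x = spinorBubble γ (Φ₀ + Φ₁) (Φ₀ - Φ₁) x := by
  rw [psiNeg, psiPos, spinorBubble, ← smul_add, map_sub]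
  congr 1
  abel

lemma clifford_apply_self {γ : EuclideanSpace ℝ (Fin n) →ₗ[ℝ] H →ₗ[ℝ] H}
    (hcl : ∀ (v w : EuclideanSpace ℝ (Fin n)) (ψ : H),
      γ v (γ w ψ) + γ w (γ v ψ) = (-2 * ⟪v, w⟫) • ψ)
    (v : EuclideanSpace ℝ (Fin n)) (ψ : H) : γ v (γ v ψ) = -(‖v‖ ^ 2) • ψ := by
  have h := hcl v v ψ
  rw [real_inner_self_eq_norm_sq, ← two_smul ℝ, mul_smul] at h
  refine smul_right_injective H (two_ne_zero' ℝ) ?_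
  simp only [h, smul_smul]
  ring_nf

lemma hasDerivAt_two_div_one_add_rpow (a : ℝ) {s : ℝ} (hs : 0 < 1 + s) :
    HasDerivAt (fun s : ℝ => (2 / (1 + s)) ^ a) (-(a / 2) * (2 / (1 + s)) ^ (a + 1)) s := by
  have h1 : HasDerivAt (fun s : ℝ => 2 / (1 + s)) (-2 / (1 + s) ^ 2) s := by
    rw [show -2 / (1 + s) ^ 2 = (0 * (1 + s) - 2 * 1) / (1 + s) ^ 2 by ring]
    exact (hasDerivAt_const s (2 : ℝ)).div ((hasDerivAt_id s).const_add 1) hs.ne'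
  have hf : (0 : ℝ) < 2 / (1 + s) := by positivity
  convert h1.rpow_const (p := a) (Or.inl hf.ne') using 1
  rw [show a + 1 = (a - 1) + 2 by ring, Real.rpow_add hf, Real.rpow_two]
  field_simp

/-- The Dirac operator swaps the two spinors of a bubble, up to a conformal factor. -/
lemma dirac_spinorBubble {γ : EuclideanSpace ℝ (Fin n) →ₗ[ℝ] H →ₗ[ℝ] H}
    (hcl : ∀ (v w : EuclideanSpace ℝ (Fin n)) (ψ : H),
      γ v (γ w ψ) + γ w (γ v ψ) = (-2 * ⟪v, w⟫) • ψ)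
    (A B : H) (x : EuclideanSpace ℝ (Fin n)) :
    Dirac γ (spinorBubble γ A B) x =
      ((n : ℝ) / 2 * (2 / (1 + ‖x‖ ^ 2))) • spinorBubble γ B A x := by
  set a : ℝ := (n : ℝ) / 2 with ha
  have hs : 0 < 1 + ‖x‖ ^ 2 := by positivity
  have hf : (0 : ℝ) < 2 / (1 + ‖x‖ ^ 2) := by positivity
  have hw : HasFDerivAt (fun y : EuclideanSpace ℝ (Fin n) => (2 / (1 + ‖y‖ ^ 2) : ℝ) ^ a)
      ((-(a / 2) * (2 / (1 + ‖x‖ ^ 2)) ^ (a + 1)) • (2 • innerSL ℝ x)) x :=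
    HasDerivAt.comp_hasFDerivAt (h₂ := fun s : ℝ => (2 / (1 + s)) ^ a) x
      (hasDerivAt_two_div_one_add_rpow a hs)
      (hasStrictFDerivAt_norm_sq x).hasFDerivAt
  have hγ : HasFDerivAt (fun y => A - γ y B) (-(γ.flip B).toContinuousLinearMap) x :=
    ((γ.flip B).toContinuousLinearMap.hasFDerivAt (x := x)).const_sub A
  have hd : HasFDerivAt (spinorBubble γ A B) _ x := hw.smul hγ
  have hterm : ∀ i : Fin n, γ (EuclideanSpace.single i (1 : ℝ))
      (fderiv ℝ (spinorBubble γ A B) x (EuclideanSpace.single i (1 : ℝ))) =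
      (-a * (2 / (1 + ‖x‖ ^ 2)) ^ (a + 1)) •
        γ (x i • EuclideanSpace.single i (1 : ℝ)) (A - γ x B) +
      ((2 / (1 + ‖x‖ ^ 2)) ^ a) • B := by
    intro i
    have hsq := clifford_apply_self hcl (EuclideanSpace.single i (1 : ℝ)) B
    simp only [PiLp.norm_single, norm_one, one_pow, neg_smul, one_smul] at hsq
    rw [hd.fderiv]
    simp [hsq, EuclideanSpace.inner_single_right, smul_smul, -map_sub]
    module
  have hx : ∑ i : Fin n, x i • EuclideanSpace.single i (1 : ℝ) = x := by
    simpa using (EuclideanSpace.basisFun (Fin n) ℝ).sum_repr x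
  rw [Dirac, Finset.sum_congr rfl fun i _ => hterm i, Finset.sum_add_distrib,
    ← Finset.smul_sum, ← LinearMap.sum_apply, ← map_sum, hx, Finset.sum_const,
    Finset.card_univ, Fintype.card_fin, ← Nat.cast_smul_eq_nsmul ℝ, map_sub,
    clifford_apply_self hcl, spinorBubble, Real.rpow_add_one hf.ne',
    show (n : ℝ) = a * (2 / (1 + ‖x‖ ^ 2)) * (1 + ‖x‖ ^ 2) by rw [ha]; field_simp]
  rw [show a * (2 / (1 + ‖x‖ ^ 2)) * (1 + ‖x‖ ^ 2) / 2 = a by field_simp]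
  module

lemma norm_spinorBubble {γ : EuclideanSpace ℝ (Fin n) →ₗ[ℝ] H →ₗ[ℝ] H}
    (hcl : ∀ (v w : EuclideanSpace ℝ (Fin n)) (ψ : H),
      γ v (γ w ψ) + γ w (γ v ψ) = (-2 * ⟪v, w⟫) • ψ)
    (hsk : ∀ (v : EuclideanSpace ℝ (Fin n)) (φ ψ : H), ⟪γ v φ, ψ⟫ = - ⟪φ, γ v ψ⟫)
    {A B : H} {c : ℝ} (hc : 0 ≤ c) (hA : ‖A‖ ^ 2 = c ^ 2 / 2) (hB : ‖B‖ ^ 2 = c ^ 2 / 2)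
    {x : EuclideanSpace ℝ (Fin n)} (hAB : ⟪A, γ x B⟫ = 0) :
    ‖spinorBubble γ A B x‖ = c * (2 / (1 + ‖x‖ ^ 2)) ^ (((n : ℝ) - 1) / 2) := by
  have hf : (0 : ℝ) < 2 / (1 + ‖x‖ ^ 2) := by positivity
  have hγB : ‖γ x B‖ ^ 2 = ‖x‖ ^ 2 * ‖B‖ ^ 2 := by
    rw [← real_inner_self_eq_norm_sq, hsk, clifford_apply_self hcl, inner_smul_right,
      real_inner_self_eq_norm_sq]
    ring
  have hsub : ‖A - γ x B‖ = c * (2 / (1 + ‖x‖ ^ 2)) ^ (-(1 / 2) : ℝ) := by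
    rw [← sq_eq_sq₀ (norm_nonneg _) (by positivity), norm_sub_sq_real, hAB, hγB, hA, hB,
      mul_pow, ← Real.rpow_mul_natCast hf.le]
    norm_num
    rw [Real.rpow_neg_one]
    field_simp
  rw [spinorBubble, norm_smul, hsub, Real.norm_of_nonneg (by positivity), mul_left_comm,
    ← Real.rpow_add hf]
  ring_nf

end SpinorBubble

/-- For `n ≥ 2` and `Φ₀, Φ₁ ∈ H`, not both zero, with `⟨Φ₀, Φ₁⟩ = 0`
and `⟨Φ₀, γ(v)Φ₁⟩ = 0` for all `v`, the spinor field `φ = ψ⁻_{Φ₀} + ψ⁺_{Φ₁}` has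
nowhere-vanishing Dirac derivative, and there is `μ̃ > 0` so that
`Θ(x) = ‖Dφ(x)‖^{−2/(n+1)} Dφ(x)` satisfies `D Θ = μ̃ ‖φ‖^{2/(n−1)} φ` on `ℝⁿ`. -/
theorem bubble_combination_solves_degenerate_EL {n : ℕ} {H : Type*}
    [NormedAddCommGroup H] [InnerProductSpace ℝ H] [FiniteDimensional ℝ H]
    (hn : 2 ≤ n)
    (γ : EuclideanSpace ℝ (Fin n) →ₗ[ℝ] H →ₗ[ℝ] H)
    (hcl : ∀ (v w : EuclideanSpace ℝ (Fin n)) (ψ : H),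
      γ v (γ w ψ) + γ w (γ v ψ) = (-2 * ⟪v, w⟫) • ψ)
    (hsk : ∀ (v : EuclideanSpace ℝ (Fin n)) (φ ψ : H),
      ⟪γ v φ, ψ⟫ = - ⟪φ, γ v ψ⟫)
    (Φ₀ Φ₁ : H) (hΦ : ¬ (Φ₀ = 0 ∧ Φ₁ = 0)) (h01 : ⟪Φ₀, Φ₁⟫ = 0)
    (h01' : ∀ v : EuclideanSpace ℝ (Fin n), ⟪Φ₀, γ v Φ₁⟫ = 0)
    (φ : EuclideanSpace ℝ (Fin n) → H)
    (hφ : φ = fun x => psiNeg γ Φ₀ x + psiPos γ Φ₁ x) :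
    (∀ x : EuclideanSpace ℝ (Fin n), Dirac γ φ x ≠ 0) ∧
    ∃ μ : ℝ, 0 < μ ∧
      ∀ x : EuclideanSpace ℝ (Fin n),
        Dirac γ
          (fun y => (‖Dirac γ φ y‖ ^ (-(2 : ℝ) / ((n : ℝ) + 1))) • Dirac γ φ y) x =
        (μ * ‖φ x‖ ^ ((2 : ℝ) / ((n : ℝ) - 1))) • φ x := by
  set A := Φ₀ + Φ₁ with hA
  set B := Φ₀ - Φ₁ with hB
  have hφ' : φ = spinorBubble γ A B := by
    rw [hφ]
    exact funext fun x => psiNeg_add_psiPos γ Φ₀ Φ₁ x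
  set c : ℝ := √(2 * (‖Φ₀‖ ^ 2 + ‖Φ₁‖ ^ 2)) with hc
  have hpos : 0 < ‖Φ₀‖ ^ 2 + ‖Φ₁‖ ^ 2 := by
    rcases not_and_or.mp hΦ with h | h <;> have := norm_pos_iff.mpr h <;> positivity
  have hc0 : 0 < c := Real.sqrt_pos.mpr (by positivity)
  have hc2 : c ^ 2 = 2 * (‖Φ₀‖ ^ 2 + ‖Φ₁‖ ^ 2) := Real.sq_sqrt (by positivity)
  have hnA : ‖A‖ ^ 2 = c ^ 2 / 2 := by
    rw [hA, norm_add_sq_real, h01, hc2]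
    ring
  have hnB : ‖B‖ ^ 2 = c ^ 2 / 2 := by
    rw [hB, norm_sub_sq_real, h01, hc2]
    ring
  have hself (v : EuclideanSpace ℝ (Fin n)) (Φ : H) : ⟪Φ, γ v Φ⟫ = 0 := by
    have := hsk v Φ Φ
    rw [real_inner_comm] at this
    linarith
  have h10' (v : EuclideanSpace ℝ (Fin n)) : ⟪Φ₁, γ v Φ₀⟫ = 0 := by
    rw [← neg_eq_zero, ← hsk, real_inner_comm, h01']
  have hAB (v : EuclideanSpace ℝ (Fin n)) : ⟪A, γ v B⟫ = 0 := by
    simp [hA, hB, inner_add_left, inner_sub_right, hself, h01', h10']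
  have hBA (v : EuclideanSpace ℝ (Fin n)) : ⟪B, γ v A⟫ = 0 := by
    rw [← neg_eq_zero, ← hsk, real_inner_comm, hAB]
  have hn' : (2 : ℝ) ≤ n := by exact_mod_cast hn
  have hn1 : (n : ℝ) - 1 ≠ 0 := by linarith
  have hn2 : (n : ℝ) + 1 ≠ 0 := by linarith
  have hn3 : (0 : ℝ) < n / 2 := by linarith
  have hf (x : EuclideanSpace ℝ (Fin n)) : (0 : ℝ) < 2 / (1 + ‖x‖ ^ 2) := by positivity
  have hnorm (x : EuclideanSpace ℝ (Fin n)) : ‖Dirac γ φ x‖ =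
      ((n : ℝ) / 2 * c) * (2 / (1 + ‖x‖ ^ 2)) ^ (((n : ℝ) + 1) / 2) := by
    rw [hφ', dirac_spinorBubble hcl, norm_smul,
      norm_spinorBubble hcl hsk hc0.le hnB hnA (hBA x),
      Real.norm_of_nonneg (mul_pos hn3 (hf x)).le,
      show ((n : ℝ) + 1) / 2 = ((n : ℝ) - 1) / 2 + 1 by ring, Real.rpow_add_one (hf x).ne']
    ring
  set K : ℝ := ((n : ℝ) / 2 * c) ^ (-(2 : ℝ) / ((n : ℝ) + 1)) with hK
  have hK0 : 0 < K := by positivity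
  have hΘ : (fun y => (‖Dirac γ φ y‖ ^ (-(2 : ℝ) / ((n : ℝ) + 1))) • Dirac γ φ y) =
      spinorBubble γ ((K * (n / 2)) • B) ((K * (n / 2)) • A) := by
    funext y
    rw [spinorBubble_smul, hnorm, Real.mul_rpow (by positivity) (by positivity), ← hK,
      ← Real.rpow_mul (hf y).le,
      show ((n : ℝ) + 1) / 2 * (-2 / ((n : ℝ) + 1)) = -1 by field_simp,
      Real.rpow_neg_one, hφ', dirac_spinorBubble hcl, smul_smul]
    congr 1
    have := (hf y).ne'
    field_simp
  refine ⟨fun x => norm_pos_iff.mp ?_,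
    K * (n / 2) * (n / 2) * (c ^ ((2 : ℝ) / ((n : ℝ) - 1)))⁻¹, by positivity, fun x => ?_⟩
  · rw [hnorm]
    have := hf x
    positivity
  · rw [hΘ, dirac_spinorBubble hcl, spinorBubble_smul, hφ',
      norm_spinorBubble hcl hsk hc0.le hnA hnB (hAB x),
      Real.mul_rpow hc0.le (by positivity), ← Real.rpow_mul (hf x).le,
      show ((n : ℝ) - 1) / 2 * (2 / ((n : ℝ) - 1)) = 1 by field_simp, Real.rpow_one, smul_smul]
    congr 1
    have : c ^ ((2 : ℝ) / ((n : ℝ) - 1)) ≠ 0 := by positivity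
    field_simp
end
end
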